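/- arXiv:2510.09965 — 5 statements merged into one kernel-verified Lean document; each statement's English description precedes it below -/
import Mathlib

section
/- Let n be a finite index type and A an n×n real matrix such that the matrix powers A^t converge entrywise to the zero matrix as t → ∞. Then I − A is invertible and (I − A)⁻¹ = ∑_{t=0}^∞ A^t, where the series of matrix powers converges entrywise. -/
open Matrix Filter Topology

/-- In a complete normed ring, the geometric series of an element with a power of norm less
than one is summable. -/
theorem summable_pow_of_norm_pow_lt_one {R : Type*} [NormedRing R] [CompleteSpace R] {x : R}
    {k : ℕ} [NeZero k] (hk : ‖x ^ k‖ < 1) : Summable fun t : ℕ => x ^ t := by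
  have hprod : Summable fun p : ℕ × Fin k => (x ^ k) ^ p.1 * x ^ (p.2 : ℕ) :=
    summable_mul_of_summable_norm (summable_norm_geometric_of_norm_lt_one hk)
      (f := fun q => (x ^ k) ^ q) (g := fun r : Fin k => x ^ (r : ℕ)) Summable.of_finite
  rw [← (Nat.divModEquiv k).symm.summable_iff]
  refine hprod.congr fun p => ?_
  simp [Nat.divModEquiv, pow_add, pow_mul, mul_comm]

/-- In a complete normed ring, the geometric series of an element whose powers tend to zero
is summable. -/
theorem summable_pow_of_tendsto_pow_zero {R : Type*} [NormedRing R] [CompleteSpace R] {x : R}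
    (hx : Tendsto (fun t : ℕ => x ^ t) atTop (𝓝 0)) : Summable fun t : ℕ => x ^ t := by
  obtain ⟨k, hk, hk0⟩ := ((hx.norm.eventually_lt_const (by simp : ‖(0 : R)‖ < 1)).and
    (eventually_ne_atTop 0)).exists
  have : NeZero k := ⟨hk0⟩
  exact summable_pow_of_norm_pow_lt_one hk

/-- If the powers of a real square matrix tend to zero, then its geometric series is summable. -/
theorem Matrix.summable_pow_of_tendsto_zero {n : Type*} [Fintype n] [DecidableEq n]
    {A : Matrix n n ℝ} (hA : Tendsto (fun t : ℕ => A ^ t) atTop (𝓝 0)) :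
    Summable fun t : ℕ => A ^ t :=
  @summable_pow_of_tendsto_pow_zero _ Matrix.linftyOpNormedRing
    (inferInstanceAs (CompleteSpace (n → n → ℝ))) A hA

/-- If the powers of a real square matrix `A` converge (entrywise)
to the zero matrix, then `I - A` is invertible and `(I - A)⁻¹ = ∑_{t=0}^∞ A^t`,
the series converging entrywise. -/
theorem matrix_geometric_series {n : Type*} [Fintype n] [DecidableEq n]
    (A : Matrix n n ℝ)
    (hA : Filter.Tendsto (fun t : ℕ => A ^ t) Filter.atTop (nhds (0 : Matrix n n ℝ))) :
    IsUnit (1 - A) ∧ HasSum (fun t : ℕ => A ^ t) (1 - A)⁻¹ := by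
  have hs := Matrix.summable_pow_of_tendsto_zero hA
  have hl : (1 - A) * ∑' t : ℕ, A ^ t = 1 := hs.one_sub_mul_tsum_pow
  have hr : (∑' t : ℕ, A ^ t) * (1 - A) = 1 := hs.tsum_pow_mul_one_sub
  refine ⟨IsUnit.of_mul_eq_one _ hl, ?_⟩
  rw [Matrix.inv_eq_left_inv hr]
  exact hs.hasSum
end

section
/- (Value linearity of homomorphic Markov chains.) Let P_S be a row-stochastic n×n real matrix with reward vector R_S ∈ ℝⁿ, P_U a row-stochastic m×m real matrix, P_ν an m×n real matrix, and γ ∈ (0,1). Assume the homomorphism conditions P_U · P_ν = P_ν · P_S and R_U = P_ν · R_S. Then the value functions satisfy V_U = P_ν · V_S, where V_S = (I − γP_S)⁻¹ R_S and V_U = (I − γP_U)⁻¹ R_U. -/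
open Matrix

/-- A real matrix is row-stochastic if all its entries are nonnegative and each row sums to 1. -/
def RowStochastic {n : Type*} [Fintype n] (P : Matrix n n ℝ) : Prop :=
  (∀ i j, 0 ≤ P i j) ∧ ∀ i, ∑ j, P i j = 1

/-- For a row-stochastic `P` and a discount factor `γ ∈ (0, 1)`, the matrix `1 - γ P` is strictly
diagonally dominant, hence invertible. -/
lemma RowStochastic.isUnit_det_one_sub_smul {n : Type*} [Fintype n] [DecidableEq n]
    {P : Matrix n n ℝ} (hP : RowStochastic P) {γ : ℝ} (hγ : γ ∈ Set.Ioo (0 : ℝ) 1) :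
    IsUnit (1 - γ • P).det := by
  refine isUnit_iff_ne_zero.mpr (det_ne_zero_of_sum_row_lt_diag fun k => ?_)
  have hoff : ∑ j ∈ Finset.univ.erase k, ‖(1 - γ • P) k j‖
      = γ * ∑ j ∈ Finset.univ.erase k, P k j := by
    rw [Finset.mul_sum]
    refine Finset.sum_congr rfl fun j hj => ?_
    have hkj : k ≠ j := (Finset.ne_of_mem_erase hj).symm
    simp [Matrix.one_apply_ne hkj, abs_of_pos hγ.1, abs_of_nonneg (hP.1 k j)]
  have hsum : P k k + ∑ j ∈ Finset.univ.erase k, P k j = 1 := by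
    rw [Finset.add_sum_erase _ _ (Finset.mem_univ k), hP.2 k]
  have hdiag : (1 - γ • P) k k = 1 - γ * P k k := by simp
  rw [hoff, hdiag, Real.norm_eq_abs]
  refine lt_of_lt_of_le ?_ (le_abs_self _)
  have hγ_lt := hγ.2
  linear_combination hγ_lt + γ * hsum

/-- **Value linearity of homomorphic Markov chains.**
Under the homomorphism conditions `P_U ⬝ P_ν = P_ν ⬝ P_S` and `R_U = P_ν ⬝ R_S`,
the value functions satisfy `V_U = P_ν ⬝ V_S`, where `V_S = (I - γP_S)⁻¹ R_S` and
`V_U = (I - γP_U)⁻¹ R_U`. -/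
theorem value_linearity_of_homomorphic_chain {m n : Type*} [Fintype m] [Fintype n]
    [DecidableEq m] [DecidableEq n]
    (P_S : Matrix n n ℝ) (hS : RowStochastic P_S) (R_S : n → ℝ)
    (P_U : Matrix m m ℝ) (hU : RowStochastic P_U) (R_U : m → ℝ)
    (P_ν : Matrix m n ℝ) (γ : ℝ) (hγ : γ ∈ Set.Ioo (0 : ℝ) 1)
    (hP : P_U * P_ν = P_ν * P_S) (hR : R_U = P_ν *ᵥ R_S)
    (V_S : n → ℝ) (hVS : V_S = (1 - γ • P_S)⁻¹ *ᵥ R_S)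
    (V_U : m → ℝ) (hVU : V_U = (1 - γ • P_U)⁻¹ *ᵥ R_U) :
    V_U = P_ν *ᵥ V_S := by
  have hcomm : (1 - γ • P_U) * P_ν = P_ν * (1 - γ • P_S) := by
    simp [Matrix.sub_mul, Matrix.mul_sub, hP]
  have hinv : (1 - γ • P_U)⁻¹ * P_ν = P_ν * (1 - γ • P_S)⁻¹ := by
    calc (1 - γ • P_U)⁻¹ * P_ν
        = (1 - γ • P_U)⁻¹ * (P_ν * (1 - γ • P_S) * (1 - γ • P_S)⁻¹) := by
          rw [Matrix.mul_nonsing_inv_cancel_right _ _ (hS.isUnit_det_one_sub_smul hγ)]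
      _ = P_ν * (1 - γ • P_S)⁻¹ := by
          rw [← hcomm, Matrix.mul_assoc,
            Matrix.nonsing_inv_mul_cancel_left _ _ (hU.isUnit_det_one_sub_smul hγ)]
  rw [hVU, hVS, hR, Matrix.mulVec_mulVec, Matrix.mulVec_mulVec, hinv]
end

section
/- (Sufficiency direction of the homomorphic-mapping existence theorem.) Let P_ν be an m×n real matrix such that P_ν P_νᵀ is invertible, and define its pseudoinverse P_ν† = P_νᵀ (P_ν P_νᵀ)⁻¹. Let P be an n×n real matrix whose rows lie in the row space of P_ν, i.e., there exists an n×m real matrix D with P = D · P_ν. Then the matrix P_U := P_ν · P · P_ν† satisfies P_U · P_ν = P_ν · P. -/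
open Matrix

/-- **Sufficiency direction of the homomorphic-mapping existence theorem.**
If `P_ν P_νᵀ` is invertible, `P_ν† = P_νᵀ (P_ν P_νᵀ)⁻¹`, and `P = D ⬝ P_ν` for some `D`,
then `P_U := P_ν ⬝ P ⬝ P_ν†` satisfies `P_U ⬝ P_ν = P_ν ⬝ P`. -/
theorem constructed_abstract_dynamics_intertwines {m n : Type*} [Fintype m] [Fintype n]
    [DecidableEq m] [DecidableEq n]
    (P_ν : Matrix m n ℝ) (hν : IsUnit (P_ν * P_νᵀ))
    (P : Matrix n n ℝ) (D : Matrix n m ℝ) (hD : P = D * P_ν) :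
    (P_ν * P * (P_νᵀ * (P_ν * P_νᵀ)⁻¹)) * P_ν = P_ν * P := by
  have hright : P_ν * (P_νᵀ * (P_ν * P_νᵀ)⁻¹) = 1 := by
    rw [← Matrix.mul_assoc, mul_nonsing_inv _ ((isUnit_iff_isUnit_det _).mp hν)]
  rw [hD, ← Matrix.mul_assoc P_ν D P_ν, Matrix.mul_assoc (P_ν * D) P_ν, hright, Matrix.mul_one]
end

section
/- (Performance-gap bound.) Let ξ ∈ ℝⁿ be a probability vector, P a row-stochastic n×n real matrix, γ ∈ (0,1), M an n×n real matrix such that I − γM is invertible, and R ∈ ℝⁿ. Set V = (I − γP)⁻¹R and V̂ = (I − γM)⁻¹R. Then |ξᵀV − ξᵀV̂| ≤ (γ/(1 − γ)) · max_s |((P − M)V̂)(s)|, where the maximum is over all states s. -/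
open Matrix

/-- A real vector is a probability vector if its entries are nonnegative and sum to 1. -/
def ProbVector {m : Type*} [Fintype m] (ξ : m → ℝ) : Prop :=
  (∀ u, 0 ≤ ξ u) ∧ ∑ u, ξ u = 1

/-- Averaging a bounded vector against a probability vector preserves the bound. -/
theorem ProbVector.abs_dotProduct_le {m : Type*} [Fintype m] {w : m → ℝ} (hw : ProbVector w)
    {x : m → ℝ} {c : ℝ} (hx : ∀ j, |x j| ≤ c) : |w ⬝ᵥ x| ≤ c :=
  calc |∑ j, w j * x j| ≤ ∑ j, |w j * x j| := Finset.abs_sum_le_sum_abs _ _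
    _ ≤ ∑ j, w j * c := Finset.sum_le_sum fun j _ => by
        rw [abs_mul, abs_of_nonneg (hw.1 j)]
        exact mul_le_mul_of_nonneg_left (hx j) (hw.1 j)
    _ = c := by rw [← Finset.sum_mul, hw.2, one_mul]

theorem RowStochastic.probVector_row {n : Type*} [Fintype n] {P : Matrix n n ℝ}
    (hP : RowStochastic P) (i : n) : ProbVector (P i) :=
  ⟨hP.1 i, hP.2 i⟩

/-- A solution of `(1 - γP)x = g` is bounded by `b / (1 - γ)` whenever `g` is bounded by `b`. -/
theorem RowStochastic.abs_le_of_abs_resolvent_le {n : Type*} [Fintype n] [DecidableEq n]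
    {P : Matrix n n ℝ} (hP : RowStochastic P) {γ : ℝ} (hγ₀ : 0 ≤ γ) (hγ₁ : γ < 1)
    {x : n → ℝ} {b : ℝ} (hx : ∀ i, |((1 - γ • P) *ᵥ x) i| ≤ b) (i : n) :
    |x i| ≤ b / (1 - γ) := by
  have : Nonempty n := ⟨i⟩
  obtain ⟨k, hk⟩ := Finite.exists_max fun j => |x j|
  refine (hk i).trans ?_
  have hPx : |(P *ᵥ x) k| ≤ |x k| := (hP.probVector_row k).abs_dotProduct_le hk
  have hsplit : x k = ((1 - γ • P) *ᵥ x) k + γ * (P *ᵥ x) k := by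
    simp [sub_mulVec, smul_mulVec]
  have htri := abs_add_le (((1 - γ • P) *ᵥ x) k) (γ * (P *ᵥ x) k)
  rw [← hsplit, abs_mul, abs_of_nonneg hγ₀] at htri
  rw [le_div_iff₀ (sub_pos.2 hγ₁)]
  linarith [hx k, mul_le_mul_of_nonneg_left hPx hγ₀]

theorem RowStochastic.isUnit_one_sub_smul {n : Type*} [Fintype n] [DecidableEq n]
    {P : Matrix n n ℝ} (hP : RowStochastic P) {γ : ℝ} (hγ₀ : 0 ≤ γ) (hγ₁ : γ < 1) :
    IsUnit (1 - γ • P) := by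
  rw [← mulVec_injective_iff_isUnit]
  intro x y hxy
  have hzero : (1 - γ • P) *ᵥ (x - y) = 0 := by
    rw [mulVec_sub]
    exact sub_eq_zero.2 hxy
  funext i
  have hi := hP.abs_le_of_abs_resolvent_le hγ₀ hγ₁ (x := x - y) (b := 0) (by simp [hzero]) i
  rw [zero_div, abs_nonpos_iff] at hi
  exact sub_eq_zero.1 hi

/-- **Performance-gap bound.**
With `V = (I - γP)⁻¹R` and `V̂ = (I - γM)⁻¹R`,
`|ξᵀV - ξᵀV̂| ≤ (γ/(1 - γ)) · max_s |((P - M)V̂)(s)|`. -/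
theorem performance_gap_bound {n : Type*} [Fintype n] [DecidableEq n]
    (ξ : n → ℝ) (hξ : ProbVector ξ)
    (P : Matrix n n ℝ) (hP : RowStochastic P)
    (γ : ℝ) (hγ : γ ∈ Set.Ioo (0 : ℝ) 1)
    (M : Matrix n n ℝ) (hM : IsUnit (1 - γ • M)) (R : n → ℝ)
    (V : n → ℝ) (hV : V = (1 - γ • P)⁻¹ *ᵥ R)
    (Vhat : n → ℝ) (hVhat : Vhat = (1 - γ • M)⁻¹ *ᵥ R) :
    |ξ ⬝ᵥ V - ξ ⬝ᵥ Vhat| ≤ γ / (1 - γ) * ⨆ s, |((P - M) *ᵥ Vhat) s| := by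
  have hsolve {A : Matrix n n ℝ} (hA : IsUnit A) : A *ᵥ (A⁻¹ *ᵥ R) = R := by
    rw [mulVec_mulVec, mul_nonsing_inv _ ((isUnit_iff_isUnit_det A).1 hA), one_mulVec]
  have hVeq : (1 - γ • P) *ᵥ V = R := by
    rw [hV, hsolve (hP.isUnit_one_sub_smul hγ.1.le hγ.2)]
  have hVhateq : (1 - γ • M) *ᵥ Vhat = R := by rw [hVhat, hsolve hM]
  have hgap : (1 - γ • P) *ᵥ (V - Vhat) = γ • ((P - M) *ᵥ Vhat) := by
    rw [mulVec_sub, hVeq, ← hVhateq, ← sub_mulVec, ← smul_mulVec]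
    congr 1
    rw [smul_sub]
    abel
  rw [← dotProduct_sub, div_mul_eq_mul_div]
  refine hξ.abs_dotProduct_le (hP.abs_le_of_abs_resolvent_le hγ.1.le hγ.2 fun i => ?_)
  rw [hgap, Pi.smul_apply, smul_eq_mul, abs_mul, abs_of_pos hγ.1]
  exact mul_le_mul_of_nonneg_left
    (le_ciSup (f := fun s => |((P - M) *ᵥ Vhat) s|) (Set.finite_range _).bddAbove i) hγ.1.le
end

section
/- (Every encoding Markov chain admits a homomorphic abstract chain.) Let P_ν be an m×n real matrix, C an n×m real matrix, γ ∈ (0,1), and R ∈ ℝⁿ, and suppose I − γ C P_ν is invertible. Let V̂ = (I − γ C P_ν)⁻¹ R be the value function of the encoding chain with transition matrix C P_ν. Then the vector V_U := P_ν V̂ satisfies the abstract Bellman equation V_U = P_ν R + γ (P_ν C) V_U; in particular, if I − γ P_ν C is also invertible, then V_U = (I − γ P_ν C)⁻¹ (P_ν R). -/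
open Matrix

/-- **Every encoding Markov chain admits a homomorphic abstract chain.**
If `I - γ C P_ν` is invertible and `V̂ = (I - γ C P_ν)⁻¹ R`, then `V_U := P_ν V̂`
satisfies the abstract Bellman equation `V_U = P_ν R + γ (P_ν C) V_U`; moreover,
if `I - γ P_ν C` is invertible, then `V_U = (I - γ P_ν C)⁻¹ (P_ν R)`. -/
theorem encoding_chain_abstract_bellman {m n : Type*} [Fintype m] [Fintype n]
    [DecidableEq m] [DecidableEq n]
    (P_ν : Matrix m n ℝ) (C : Matrix n m ℝ)
    (γ : ℝ) (hγ : γ ∈ Set.Ioo (0 : ℝ) 1) (R : n → ℝ)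
    (h : IsUnit (1 - γ • (C * P_ν)))
    (Vhat : n → ℝ) (hVhat : Vhat = (1 - γ • (C * P_ν))⁻¹ *ᵥ R)
    (V_U : m → ℝ) (hVU : V_U = P_ν *ᵥ Vhat) :
    V_U = P_ν *ᵥ R + γ • ((P_ν * C) *ᵥ V_U) ∧
      (IsUnit (1 - γ • (P_ν * C)) → V_U = (1 - γ • (P_ν * C))⁻¹ *ᵥ (P_ν *ᵥ R)) := by
  have hR : R = Vhat - γ • ((C * P_ν) *ᵥ Vhat) := by
    have hdet := (Matrix.isUnit_iff_isUnit_det _).mp h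
    have hV : (1 - γ • (C * P_ν)) *ᵥ Vhat = R := by
      rw [hVhat, mulVec_mulVec, mul_nonsing_inv _ hdet, one_mulVec]
    rw [← hV, sub_mulVec, one_mulVec, smul_mulVec]
  have bellman : V_U = P_ν *ᵥ R + γ • ((P_ν * C) *ᵥ V_U) := by
    rw [hR, mulVec_sub, mulVec_smul, mulVec_mulVec, hVU, mulVec_mulVec, Matrix.mul_assoc,
      sub_add_cancel]
  refine ⟨bellman, fun hU => ?_⟩
  have hdet := (Matrix.isUnit_iff_isUnit_det _).mp hU
  have hPR : P_ν *ᵥ R = (1 - γ • (P_ν * C)) *ᵥ V_U := by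
    rw [sub_mulVec, one_mulVec, smul_mulVec]
    exact eq_sub_of_add_eq bellman.symm
  rw [hPR, mulVec_mulVec, nonsing_inv_mul _ hdet, one_mulVec]
end
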